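/- (Smale's α-theorem.) Let g : ℂⁿ → ℂⁿ be a square polynomial system (each coordinate the evaluation of a multivariate polynomial) and ẑ ∈ ℂⁿ a point where the Jacobian Dg(ẑ) is invertible. If α(g,ẑ) < (13 − 3√17)/4, then there exists ζ ∈ ℂⁿ with g(ζ) = 0 such that ‖ζ − ẑ‖ ≤ 2β(g,ẑ), all Newton iterates N_g^k(ẑ) are defined (the Jacobian is invertible at each iterate), and ‖N_g^k(ẑ) − ζ‖ ≤ (1/2)^{2ᵏ − 1} · 2β(g,ẑ) for all k ∈ ℕ; in particular the Newton iterates converge quadratically to ζ. -/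

import Mathlib

open MvPolynomial

/-- The Newton operator `N_g(z) = z − Dg(z)⁻¹ g(z)` of a map `g : ℂⁿ → ℂⁿ`, written with
`ContinuousLinearMap.inverse` (which is the inverse where the Jacobian is invertible,
and the zero map elsewhere). -/
noncomputable def newtonMap {n : ℕ} (g : EuclideanSpace ℂ (Fin n) → EuclideanSpace ℂ (Fin n))
    (z : EuclideanSpace ℂ (Fin n)) : EuclideanSpace ℂ (Fin n) :=
  z - (fderiv ℂ g z).inverse (g z)

/-- The Jacobian of `g` at `z` is invertible, i.e. it is a continuous linear isomorphism. -/
def jacobianInvertible {n : ℕ} (g : EuclideanSpace ℂ (Fin n) → EuclideanSpace ℂ (Fin n))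
    (z : EuclideanSpace ℂ (Fin n)) : Prop :=
  ∃ e : EuclideanSpace ℂ (Fin n) ≃L[ℂ] EuclideanSpace ℂ (Fin n),
    (e : EuclideanSpace ℂ (Fin n) →L[ℂ] EuclideanSpace ℂ (Fin n)) = fderiv ℂ g z

/-- `β(g, zhat) = ‖Dg(zhat)⁻¹ g(zhat)‖`, the length of a Newton step. -/
noncomputable def betaVal {n : ℕ} (g : EuclideanSpace ℂ (Fin n) → EuclideanSpace ℂ (Fin n))
    (zhat : EuclideanSpace ℂ (Fin n)) : ℝ :=
  ‖(fderiv ℂ g zhat).inverse (g zhat)‖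

/-- `γ(g, zhat) = sup_{k ≥ 2} ‖Dg(zhat)⁻¹ ∘ (1/k!)·Dᵏg(zhat)‖^{1/(k−1)}`. -/
noncomputable def gammaVal {n : ℕ} (g : EuclideanSpace ℂ (Fin n) → EuclideanSpace ℂ (Fin n))
    (zhat : EuclideanSpace ℂ (Fin n)) : ℝ :=
  ⨆ k : ℕ, if 2 ≤ k then
      (‖((fderiv ℂ g zhat).inverse).compContinuousMultilinearMap
          (iteratedFDeriv ℂ k g zhat)‖ / (k.factorial : ℝ)) ^ (((k : ℝ) - 1)⁻¹)
    else 0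

/-- `α(g, zhat) = β(g, zhat) · γ(g, zhat)`. -/
noncomputable def alphaVal {n : ℕ} (g : EuclideanSpace ℂ (Fin n) → EuclideanSpace ℂ (Fin n))
    (zhat : EuclideanSpace ℂ (Fin n)) : ℝ :=
  betaVal g zhat * gammaVal g zhat

open scoped ContDiff Nat

lemma sc_newton (u Q d w N M K δ τ τ' : ℝ) (hd : d = 1-2*u) (hw : w = 1-u)
  (hN : N = d - 2*u*w*Q) (hM : M = d^2-2*u^2*Q^2) (hK : K = d*w-u*Q) (hδ : δ = 1-4*u+2*u^2)
  (d0 : 0 < d) (w0 : 0 < w) (N0 : 0 < N) (M0 : 0 < M) (K0 : 0 < K) 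
  (hτ : τ = (1-Q)*d/N) (hτ' : τ' = (w*d-Q^2*u)*d/(w*M)) :
  τ' - τ = Q*δ*d*K/(N*w*M) ∧ 1 - u*τ = K/N ∧ 1 - τ = Q*δ/N ∧ (d/w - τ + u*τ^2/(1-u*τ)) + (1/(1-u*τ)^2 - 2)*(τ' - τ) = 0 := by
  have e1 : τ' - τ = Q*δ*d*K/(N*w*M) := by
    rw [hτ, hτ']; field_simp; rw [hN, hM, hK, hδ, hd, hw]; ring
  have e2 : 1 - u*τ = K/N := by
    rw [hτ]; field_simp; rw [hN, hK, hd, hw]; ring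
  have e4 : 1 - τ = Q*δ/N := by
    rw [hτ]; field_simp; rw [hN, hδ, hd, hw]; ring
  refine ⟨e1, e2, e4, ?_⟩
  have e3 : d/w - τ + u*τ^2/(1-u*τ) = Q*δ^2*d/(N*K*w) := by
    rw [e2, hτ]; field_simp; rw [hN, hK, hδ, hd, hw]; ring
  have e5 : 1/(1-u*τ)^2 - 2 = -(δ*M)/K^2 := by
    rw [e2]; field_simp; rw [hN, hK, hδ, hM, hd, hw]; ring
  rw [e3, e5, e1]; field_simp; ring

lemma sc_u (α : ℝ) (h0 : 0 ≤ α) (h1 : α < (13 - 3 * Real.sqrt 17) / 4) :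
    ∃ u, 0 ≤ u ∧ u < 0.22 ∧ 0 ≤ 2*u^2-5*u+1 ∧ u*(1-2*u) = α*(1-u) := by
  have hs : Real.sqrt 17 ^ 2 = 17 := Real.sq_sqrt (by norm_num)
  have hs1 : 4.123 < Real.sqrt 17 := Real.lt_sqrt_of_sq_lt (by norm_num)
  set s := Real.sqrt 17
  have hs2 : s < 4.124 := by nlinarith
  set u0 := (5 - s)/4 with hu0
  have hc : ContinuousOn (fun u : ℝ => u*(1-2*u)/(1-u)) (Set.Icc 0 u0) := by
    apply ContinuousOn.div (by fun_prop) (by fun_prop)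
    intro x hx; have := hx.2; apply ne_of_gt; linarith
  have hv : u0*(1-2*u0)/(1-u0) = (13-3*s)/4 := by
    have : 0 < 1 - u0 := by linarith
    rw [div_eq_iff this.ne', hu0]; nlinarith
  obtain ⟨u, hu, hval⟩ := intermediate_value_Icc (by linarith : (0:ℝ) ≤ u0) hc
    (show α ∈ _ by rw [Set.mem_Icc]; simp only [hv]; constructor <;> [simpa using h0; exact h1.le])
  have h3 : 0 < 1 - u := by have := hu.2; linarith
  refine ⟨u, hu.1, by have := hu.2; linarith, ?_, ?_⟩
  · have : 0 ≤ (u0 - u) * ((5+s)/4 - u) := by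
      apply mul_nonneg <;> linarith [hu.2]
    rw [hu0] at this; nlinarith
  · simp only at hval; rwa [div_eq_iff h3.ne'] at hval

lemma scalar_seq (β γ : ℝ) (hβ : 0 ≤ β) (hγ : 0 ≤ γ) (hα : β * γ < (13 - 3 * Real.sqrt 17) / 4) :
    ∃ (t : ℕ → ℝ) (a : ℝ), t 0 = 0 ∧ (∀ k, 0 ≤ t k) ∧ (∀ k, t k ≤ t (k+1)) ∧
      (∀ k, t k ≤ a) ∧ (∀ k, a - t k ≤ (1/2:ℝ)^(2^k-1) * (2*β)) ∧
      (∀ k, γ * t k < 1) ∧ (∀ k, 1/(1-γ * t k)^2 < 2) ∧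
      (∀ k, (β - t k + γ * (t k)^2/(1-γ * t k)) + (1/(1-γ * t k)^2-2)*(t (k+1) - t k) = 0) := by
  obtain ⟨u, u0, u1, u2, hu⟩ := sc_u (β*γ) (by positivity) hα
  obtain ⟨d, hd⟩ : ∃ d, d = 1-2*u := ⟨_, rfl⟩
  obtain ⟨w, hw⟩ : ∃ w, w = 1-u := ⟨_, rfl⟩
  obtain ⟨δ, hδ⟩ : ∃ δ, δ = 1-4*u+2*u^2 := ⟨_, rfl⟩
  have d0 : 0 < d := by linarith
  have w0 : 0 < w := by linarith
  have δ0 : 0 < δ := by nlinarith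
  have dw : d = δ + 2*u*w := by rw [hd, hδ, hw]; ring
  have uw0 : 0 ≤ u*w := by positivity
  obtain ⟨q, hq⟩ : ∃ q, q = u/(w*d) := ⟨_, rfl⟩
  have q0 : 0 ≤ q := by rw [hq]; positivity
  have q1 : q ≤ 1/2 := by
    rw [hq, div_le_iff₀ (by positivity), hw, hd]; nlinarith
  have hqe : q * (w*d) = u := by rw [hq]; field_simp
  let Q : ℕ → ℝ := fun k => q^(2^k-1)
  have Q0 : ∀ k, 0 ≤ Q k := fun k => by positivity
  have Q1 : ∀ k, Q k ≤ 1 := fun k => pow_le_one₀ q0 (by linarith)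
  have Qh : ∀ k, Q k ≤ (1/2)^(2^k-1) := fun k => pow_le_pow_left₀ q0 q1 _
  have Qs : ∀ k, Q (k+1) = Q k ^2 * q := fun k => by
    simp only [Q]; rw [← pow_mul, ← pow_succ]; congr 1
    have : 1 ≤ 2^k := Nat.one_le_two_pow
    rw [pow_succ]; omega
  let N : ℕ → ℝ := fun k => d - 2*u*w*Q k
  have Nδ : ∀ k, δ ≤ N k := fun k => by
    simp only [N]; nlinarith [mul_le_mul_of_nonneg_left (Q1 k) uw0]
  have N0 : ∀ k, 0 < N k := fun k => lt_of_lt_of_le δ0 (Nδ k)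
  let τ : ℕ → ℝ := fun k => (1-Q k)*d/N k
  have M0 : ∀ k, 0 < d^2 - 2*u^2*Q k^2 := fun k => by
    have : Q k ^2 ≤ 1 := pow_le_one₀ (Q0 k) (Q1 k)
    have h := mul_le_mul_of_nonneg_left this (sq_nonneg u)
    rw [hd]; nlinarith
  have K0 : ∀ k, 0 < d*w - u*Q k := fun k => by
    have h := mul_le_mul_of_nonneg_left (Q1 k) u0
    have : d*w = 1-3*u+2*u^2 := by rw [hd, hw]; ring
    nlinarith
  have hτ' : ∀ k, τ (k+1) = (w*d-Q k^2*u)*d/(w*(d^2 - 2*u^2*Q k^2)) := fun k => by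
    have h1 := N0 (k+1)
    simp only [τ]
    rw [div_eq_div_iff h1.ne' (mul_pos w0 (M0 k)).ne']
    simp only [N]
    rw [Qs k]
    linear_combination (2*u*Q k^2*w*d-d^2*Q k^2)*hqe - 0*hqe
  have key := fun k => sc_newton u (Q k) d w (N k) _ _ δ (τ k) (τ (k+1)) hd hw rfl rfl rfl hδ
    d0 w0 (N0 k) (M0 k) (K0 k) rfl (hτ' k)
  obtain ⟨a, ha⟩ : ∃ a, a = β*w/d := ⟨_, rfl⟩
  have a0 : 0 ≤ a := by rw [ha]; positivity
  have γa : γ * a = u := by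
    rw [ha]; rw [← hd, ← hw] at hu; field_simp; linarith
  have βa : β = a * (d/w) := by rw [ha]; field_simp
  have a2 : a ≤ 2*β := by
    rw [ha, div_le_iff₀ d0]; nlinarith
  have τ0 : ∀ k, 0 ≤ τ k := fun k => by
    have := N0 k; have := Q1 k
    exact div_nonneg (mul_nonneg (by linarith) d0.le) (N0 k).le
  have τQ : ∀ k, 1 - τ k ≤ Q k := fun k => by
    rw [(key k).2.2.1, div_le_iff₀ (N0 k)]
    exact mul_le_mul_of_nonneg_left (Nδ k) (Q0 k)
  have τ1 : ∀ k, τ k ≤ 1 := fun k => by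
    have : 0 ≤ 1 - τ k := by
      rw [(key k).2.2.1]; exact div_nonneg (mul_nonneg (Q0 k) δ0.le) (N0 k).le
    linarith
  have γt : ∀ k, γ * (a * τ k) = u * τ k := fun k => by rw [← mul_assoc, γa]
  have uτ : ∀ k, u * τ k ≤ 0.22 := fun k => by
    have := mul_le_mul_of_nonneg_left (τ1 k) u0; linarith
  refine ⟨fun k => a * τ k, a, ?_, ?_, ?_, ?_, ?_, ?_, ?_, ?_⟩
  · simp [τ, Q]
  · exact fun k => mul_nonneg a0 (τ0 k)
  · intro k
    apply mul_le_mul_of_nonneg_left _ a0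
    have : 0 ≤ τ (k+1) - τ k := by
      rw [(key k).1]
      have := Q0 k; have := N0 k; have := M0 k; have := K0 k
      positivity
    linarith
  · intro k; have := mul_le_mul_of_nonneg_left (τ1 k) a0; simpa using this
  · intro k
    calc a - a * τ k = (1-τ k) * a := by ring
      _ ≤ (1/2:ℝ)^(2^k-1) * (2*β) :=
        mul_le_mul ((τQ k).trans (Qh k)) a2 a0 (by positivity)
  · intro k; simp only [γt]; linarith [uτ k]
  · intro k; simp only [γt]
    have := uτ k
    rw [div_lt_iff₀ (by apply pow_pos; linarith)]; nlinarith
  · intro k; simp only [γt]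
    have h := (key k).2.2.2
    have e : γ * (a * τ k)^2 = a * (u * τ k^2) := by rw [← γa]; ring
    rw [e, mul_div_assoc]
    nth_rewrite 1 [βa]
    linear_combination a * h


lemma sm_taylor {E F : Type*} [NormedAddCommGroup E] [NormedSpace ℂ E] [NormedAddCommGroup F]
    [NormedSpace ℂ F] [CompleteSpace F] (G : E → F) (hG : ContDiff ℂ ω G) (z0 v : E)
    (c : ℕ → ℝ) (hc : ∀ n, ‖iteratedFDeriv ℂ n G z0‖ ≤ n ! * c n) (S : ℝ)
    (hS : HasSum (fun n => c n * ‖v‖^n) S) : ‖G (z0 + v)‖ ≤ S := by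
  let L : ℂ →L[ℂ] E := (ContinuousLinearMap.id ℂ ℂ).smulRight v
  have hG2 : ContDiff ℂ ω (fun x => G (z0 + x)) := hG.comp (by fun_prop)
  let ph : ℂ → F := (fun x => G (z0 + x)) ∘ L
  have hph : Differentiable ℂ ph := (hG2.comp L.contDiff).differentiable (by simp)
  have h := Complex.hasSum_taylorSeries_of_entire hph 0 1
  have hLn : ‖L‖ ≤ ‖v‖ := by
    apply ContinuousLinearMap.opNorm_le_bound _ (norm_nonneg _)
    intro x; simp [L, norm_smul, mul_comm]
  have hb : ∀ n, ‖(n ! : ℂ)⁻¹ • ((1:ℂ) - 0) ^ n • iteratedDeriv n ph 0‖ ≤ c n * ‖v‖^n := by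
    intro n
    have h1 : ‖iteratedDeriv n ph 0‖ ≤ n ! * c n * ‖v‖^n := by
      rw [← norm_iteratedFDeriv_eq_norm_iteratedDeriv]
      simp only [ph]
      rw [L.iteratedFDeriv_comp_right hG2 0 (i := n) (by exact_mod_cast le_top),
        iteratedFDeriv_comp_add_left]
      refine (ContinuousMultilinearMap.norm_compContinuousLinearMap_le _ _).trans ?_
      simp only [map_zero, add_zero, Finset.prod_const, Finset.card_fin]
      apply mul_le_mul (hc n) (pow_le_pow_left₀ (norm_nonneg _) hLn n) (by positivity)
      exact (norm_nonneg _).trans (hc n)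
    have hf : (0:ℝ) < n ! := by positivity
    rw [norm_smul, norm_smul, norm_inv]
    simp only [sub_zero, one_pow, norm_one, one_mul, Complex.norm_natCast]
    rw [inv_mul_le_iff₀ hf]; linarith
  have h2 := h.tsum_eq
  have : ph 1 = G (z0 + v) := by simp [ph, L]
  rw [← this, ← h2]
  exact tsum_of_norm_bounded hS hb

lemma sm_second {E : Type*} [NormedAddCommGroup E] [NormedSpace ℂ E] [CompleteSpace E]
    (f : E → E) (hf : ContDiff ℂ ω f) (z0 : E) (γ : ℝ) (hγ : 0 ≤ γ)
    (hc : ∀ k, 2 ≤ k → ‖iteratedFDeriv ℂ k f z0‖ ≤ k ! * γ^(k-1)) (z : E) (r : ℝ)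
    (hr : ‖z - z0‖ ≤ r) (hr1 : γ * r < 1) :
    ‖fderiv ℂ (fderiv ℂ f) z‖ ≤ 2*γ/(1-γ*r)^3 := by
  have hF : ContDiff ℂ ω (fderiv ℂ f) := hf.fderiv_right (by simp)
  have hG : ContDiff ℂ ω (fderiv ℂ (fderiv ℂ f)) := hF.fderiv_right (by simp)
  have hle : γ * ‖z - z0‖ ≤ γ * r := mul_le_mul_of_nonneg_left hr hγ
  have hnn : 0 ≤ γ * ‖z - z0‖ := by positivity
  have hs := (hasSum_choose_mul_geometric_of_norm_lt_one (𝕜 := ℝ) 2 (r := γ * ‖z-z0‖)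
    (by rw [Real.norm_of_nonneg hnn]; linarith)).mul_left (2*γ)
  have := sm_taylor _ hG z0 (z - z0) (fun n => (n+2)*(n+1) * γ^(n+1)) (by
    intro n
    rw [norm_iteratedFDeriv_fderiv, norm_iteratedFDeriv_fderiv]
    refine (hc (n+2) (by omega)).trans (le_of_eq ?_)
    rw [Nat.factorial_succ, Nat.factorial_succ]; push_cast
    ring) (2*γ*(1/(1-γ*‖z-z0‖)^3)) (by
    convert! hs using 2 with n
    rw [Nat.cast_choose_two]; push_cast; ring)
  rw [add_sub_cancel] at this
  refine this.trans ?_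
  rw [mul_one_div]
  gcongr

/-- Mean value along the segment. -/
lemma sm_mv {E F : Type*} [NormedAddCommGroup E] [NormedSpace ℂ E] [NormedAddCommGroup F]
    [NormedSpace ℂ F] (G : E → F) (hG : Differentiable ℂ G) (x y : E) (s : ℝ)
    (hs : ‖y - x‖ ≤ s) (B B' : ℝ → ℝ) (hB0 : B 0 = 0)
    (hB : ∀ τ ∈ Set.Icc (0:ℝ) 1, HasDerivAt B (s * B' τ) τ)
    (hb : ∀ τ ∈ Set.Icc (0:ℝ) 1, ‖fderiv ℂ G (x + (τ:ℂ) • (y - x))‖ ≤ B' τ) :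
    ‖G y - G x‖ ≤ B 1 := by
  have hd : ∀ τ : ℝ, HasDerivAt (fun τ : ℝ => G (x + (τ:ℂ) • (y - x)) - G x)
      (fderiv ℂ G (x + (τ:ℂ) • (y - x)) (y - x)) τ := by
    intro τ
    have h1 : HasDerivAt (fun τ : ℂ => x + τ • (y - x)) (y - x) (τ:ℂ) := by
      simpa using ((hasDerivAt_id (τ:ℂ)).smul_const (y-x)).const_add x
    have h2 := (hG (x + (τ:ℂ) • (y - x))).hasFDerivAt.comp_hasDerivAt (τ:ℂ) h1
    have h3 : HasDerivAt (fun τ : ℝ => (τ:ℂ)) 1 τ := Complex.ofRealCLM.hasDerivAt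
    simpa using (HasDerivAt.scomp τ h2 h3).sub_const (G x)
  have := image_norm_le_of_norm_deriv_right_le_deriv_boundary' (a := 0) (b := 1) (B := B)
    (B' := fun τ => s * B' τ) 
    (f := fun τ : ℝ => G (x + (τ:ℂ) • (y - x)) - G x)
    (f' := fun τ : ℝ => fderiv ℂ G (x + (τ:ℂ) • (y - x)) (y - x))
    (fun τ _ => (hd τ).continuousAt.continuousWithinAt) (fun τ _ => (hd τ).hasDerivWithinAt)
    (by simp [hB0]) (fun τ hτ => (hB τ hτ).continuousAt.continuousWithinAt)
    (fun τ hτ => (hB τ ⟨hτ.1, hτ.2.le⟩).hasDerivWithinAt)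
    (by
      intro τ hτ
      have h0 := hb τ ⟨hτ.1, hτ.2.le⟩
      refine (ContinuousLinearMap.le_opNorm _ _).trans ?_
      rw [mul_comm]
      exact mul_le_mul hs h0 (norm_nonneg _) ((norm_nonneg _).trans hs))
    (Set.right_mem_Icc.2 zero_le_one)
  simpa using this

lemma sm_pt {E : Type*} [NormedAddCommGroup E] [NormedSpace ℂ E] (z0 x y : E) (t s τ : ℝ)
    (hx : ‖x - z0‖ ≤ t) (hy : ‖y - x‖ ≤ s) (h0 : 0 ≤ τ) :
    ‖x + (τ:ℂ) • (y - x) - z0‖ ≤ t + τ * s := by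
  have : x + (τ:ℂ) • (y - x) - z0 = (x - z0) + (τ:ℂ) • (y - x) := by abel
  rw [this]
  refine (norm_add_le _ _).trans (add_le_add hx ?_)
  rw [norm_smul, Complex.norm_real, Real.norm_of_nonneg h0]
  gcongr

lemma sm_lip {E : Type*} [NormedAddCommGroup E] [NormedSpace ℂ E] [CompleteSpace E]
    (f : E → E) (hf : ContDiff ℂ ω f) (z0 : E) (γ : ℝ) (hγ : 0 ≤ γ)
    (hc : ∀ k, 2 ≤ k → ‖iteratedFDeriv ℂ k f z0‖ ≤ k ! * γ^(k-1)) (x y : E) (t s : ℝ)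
    (hx : ‖x - z0‖ ≤ t) (hy : ‖y - x‖ ≤ s) (h1 : γ * (t + s) < 1) :
    ‖fderiv ℂ f y - fderiv ℂ f x‖ ≤ 1/(1-γ*(t+s))^2 - 1/(1-γ*t)^2 := by
  have hF : ContDiff ℂ ω (fderiv ℂ f) := hf.fderiv_right (by simp)
  have s0 : 0 ≤ s := (norm_nonneg _).trans hy
  have hlt : ∀ τ ∈ Set.Icc (0:ℝ) 1, γ * (t + τ * s) < 1 := fun τ hτ => by
    refine lt_of_le_of_lt (mul_le_mul_of_nonneg_left ?_ hγ) h1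
    nlinarith [hτ.2]
  have := sm_mv (fderiv ℂ f) (hF.differentiable (by simp)) x y s hy
    (fun τ => 1/(1-γ*(t+τ*s))^2 - 1/(1-γ*t)^2) (fun τ => 2*γ/(1-γ*(t+τ*s))^3) (by simp)
    (by
      intro τ hτ
      have hp : 0 < 1 - γ*(t+τ*s) := by linarith [hlt τ hτ]
      have h : HasDerivAt (fun τ : ℝ => 1-γ*(t+τ*s)) (-(γ*s)) τ := by
        simpa using ((((hasDerivAt_id τ).mul_const s).const_add t).const_mul γ).const_sub 1
      have h2 := ((h.pow 2).inv (by simpa using hp.ne')).sub_const (1/(1-γ*t)^2)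
      convert! h2 using 1
      · ext; simp
      · simp only [Pi.pow_apply]
        generalize 1-γ*(t+τ*s) = R at *
        field_simp; simp; left; ring)
    (fun τ hτ => sm_second f hf z0 γ hγ hc _ _ (sm_pt z0 x y t s τ hx hy hτ.1) (hlt τ hτ))
  simpa using this

lemma sm_rem {E : Type*} [NormedAddCommGroup E] [NormedSpace ℂ E] [CompleteSpace E]
    (f : E → E) (hf : ContDiff ℂ ω f) (z0 : E) (γ : ℝ) (hγ : 0 ≤ γ)
    (hc : ∀ k, 2 ≤ k → ‖iteratedFDeriv ℂ k f z0‖ ≤ k ! * γ^(k-1)) (x y : E) (t s : ℝ)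
    (hx : ‖x - z0‖ ≤ t) (hy : ‖y - x‖ ≤ s) (h1 : γ * (t + s) < 1) :
    ‖f y - f x - fderiv ℂ f x (y - x)‖ ≤
      (-(t+s) + γ*(t+s)^2/(1-γ*(t+s))) - (-t + γ*t^2/(1-γ*t)) - (1/(1-γ*t)^2-2) * s := by
  have s0 : 0 ≤ s := (norm_nonneg _).trans hy
  have hdf : Differentiable ℂ f := hf.differentiable (by simp)
  have hlt : ∀ τ ∈ Set.Icc (0:ℝ) 1, γ * (t + τ * s) < 1 := fun τ hτ => by
    refine lt_of_le_of_lt (mul_le_mul_of_nonneg_left ?_ hγ) h1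
    nlinarith [hτ.2]
  have hfd : ∀ z, fderiv ℂ (fun z => f z - fderiv ℂ f x z) z = fderiv ℂ f z - fderiv ℂ f x :=
    fun z => by
      rw [fderiv_fun_sub (hdf z) (ContinuousLinearMap.differentiableAt _)]; simp
  have := sm_mv (fun z => f z - fderiv ℂ f x z)
    (hdf.sub (ContinuousLinearMap.differentiable _)) x y s hy
    (fun τ => (-(t+τ*s) + γ*(t+τ*s)^2/(1-γ*(t+τ*s))) - (-t + γ*t^2/(1-γ*t))
      - (1/(1-γ*t)^2-2) * (τ*s))
    (fun τ => 1/(1-γ*(t+τ*s))^2 - 1/(1-γ*t)^2) (by simp)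
    (by
      intro τ hτ
      have hp : 0 < 1 - γ*(t+τ*s) := by linarith [hlt τ hτ]
      have h0 : HasDerivAt (fun τ : ℝ => t+τ*s) s τ := by
        simpa using ((hasDerivAt_id τ).mul_const s).const_add t
      have h : HasDerivAt (fun τ : ℝ => 1-γ*(t+τ*s)) (-(γ*s)) τ := by
        simpa using (h0.const_mul γ).const_sub 1
      have h3 := (h0.neg.add (((h0.pow 2).const_mul γ).div h hp.ne')).sub_const
        (-t + γ*t^2/(1-γ*t))
      have h4 := h3.sub (((hasDerivAt_id τ).mul_const s).const_mul (1/(1-γ*t)^2-2))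
      convert! h4 using 1
      simp only [Pi.pow_apply, Nat.cast_ofNat, Nat.add_one_sub_one, pow_one, one_mul]
      generalize 1/(1-γ*t)^2 = C
      generalize t+τ*s = R at *
      have hp2 : 1 - γ * R ≠ 0 := hp.ne'
      field_simp
      ring)
    (fun τ hτ => by
      rw [hfd]
      refine sm_lip f hf z0 γ hγ hc _ _ _ _ hx ?_ (hlt τ hτ)
      rw [add_sub_cancel_left, norm_smul, Complex.norm_real, Real.norm_of_nonneg hτ.1]
      exact mul_le_mul_of_nonneg_left hy hτ.1)
  simp only [one_mul] at this
  convert! this using 2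
  rw [map_sub]; abel

lemma sm_analytic_bound {E F : Type*} [NormedAddCommGroup E] [NormedSpace ℂ E]
    [NormedAddCommGroup F] [NormedSpace ℂ F] [CompleteSpace F] (f : E → F) (hf : ContDiff ℂ ω f)
    (z : E) : ∃ B : ℝ, 0 ≤ B ∧ ∀ k, 2 ≤ k → ‖iteratedFDeriv ℂ k f z‖ / k ! ≤ B^(k-1) := by
  have han : AnalyticAt ℂ f z := hf.contDiffAt.analyticAt
  obtain ⟨p, r, hp⟩ := han
  obtain ⟨C, a, C0, a0, hC⟩ := p.le_mul_pow_of_radius_pos (lt_of_lt_of_le hp.r_pos hp.r_le)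
  have hb : ∀ k, ‖iteratedFDeriv ℂ k f z‖ ≤ k ! * ‖p k‖ := by
    intro k
    apply ContinuousMultilinearMap.opNorm_le_bound (by positivity)
    intro v
    rw [hp.iteratedFDeriv_eq_sum_of_completeSpace]
    refine (norm_sum_le _ _).trans ?_
    have : ∀ σ ∈ (Finset.univ : Finset (Equiv.Perm (Fin k))),
        ‖p k (fun i => v (σ i))‖ ≤ ‖p k‖ * ∏ i, ‖v i‖ := by
      intro σ _
      refine ((p k).le_opNorm _).trans (le_of_eq ?_)
      rw [Equiv.prod_comp σ (fun i => ‖v i‖)]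
    refine (Finset.sum_le_sum this).trans (le_of_eq ?_)
    simp [Fintype.card_perm, mul_assoc]
  refine ⟨max 1 C * (max 1 a)^2, by positivity, fun k hk => ?_⟩
  have hk0 : (0:ℝ) < k ! := by positivity
  rw [div_le_iff₀ hk0]
  refine (hb k).trans ?_
  rw [mul_comm]
  refine mul_le_mul_of_nonneg_right ((hC k).trans ?_) hk0.le
  rw [mul_pow, ← pow_mul]
  have h1 : C ≤ (max 1 C)^(k-1) :=
    (le_max_right 1 C).trans (le_self_pow₀ (le_max_left _ _) (by omega))
  have h2 : a^k ≤ (max 1 a)^(2*(k-1)) :=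
    (pow_le_pow_left₀ a0.le (le_max_right 1 a) k).trans
      (pow_le_pow_right₀ (le_max_left _ _) (by omega))
  exact mul_le_mul h1 h2 (by positivity) (by positivity)

lemma sm_gamma {n : ℕ} (g : EuclideanSpace ℂ (Fin n) → EuclideanSpace ℂ (Fin n))
    (hg : ContDiff ℂ ω g) (z : EuclideanSpace ℂ (Fin n)) :
    0 ≤ gammaVal g z ∧ ∀ k, 2 ≤ k →
      ‖iteratedFDeriv ℂ k ((fderiv ℂ g z).inverse ∘ g) z‖ ≤ k ! * (gammaVal g z)^(k-1) := by
  set A := (fderiv ℂ g z).inverse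
  have he : ∀ k, iteratedFDeriv ℂ k (A ∘ g) z =
      A.compContinuousMultilinearMap (iteratedFDeriv ℂ k g z) := fun k =>
    A.iteratedFDeriv_comp_left hg.contDiffAt (by exact_mod_cast le_top)
  obtain ⟨B, B0, hB⟩ := sm_analytic_bound (A ∘ g) (A.contDiff.comp hg) z
  have hbdd : BddAbove (Set.range (fun k : ℕ => if 2 ≤ k then
      (‖A.compContinuousMultilinearMap
          (iteratedFDeriv ℂ k g z)‖ / (k.factorial : ℝ)) ^ (((k : ℝ) - 1)⁻¹)
    else 0)) := by
    refine ⟨B, ?_⟩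
    rintro _ ⟨k, rfl⟩
    dsimp only
    split_ifs with hk
    · rw [← he]
      have hk1 : (1:ℝ) < k := by exact_mod_cast hk
      refine (Real.rpow_le_rpow (by positivity) (hB k hk)
        (inv_nonneg.2 (by linarith))).trans (le_of_eq ?_)
      rw [show ((k:ℝ) - 1) = ((k-1 : ℕ) : ℝ) by rw [Nat.cast_sub (by omega)]; simp]
      exact Real.pow_rpow_inv_natCast B0 (by omega)
    · exact B0
  have hle : ∀ k : ℕ, (if 2 ≤ k then
      (‖A.compContinuousMultilinearMap
          (iteratedFDeriv ℂ k g z)‖ / (k.factorial : ℝ)) ^ (((k : ℝ) - 1)⁻¹)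
    else 0) ≤ gammaVal g z := fun k => le_ciSup hbdd k
  have h0 : 0 ≤ gammaVal g z := by simpa using hle 0
  refine ⟨h0, fun k hk => ?_⟩
  have h := hle k
  rw [if_pos hk, ← he, show ((k:ℝ) - 1) = ((k-1 : ℕ) : ℝ) by
    rw [Nat.cast_sub (by omega)]; simp] at h
  have h2 := pow_le_pow_left₀ (by positivity) h (k-1)
  rw [Real.rpow_inv_natCast_pow (by positivity) (by omega), div_le_iff₀ (by positivity)] at h2
  linarith

lemma sm_poly {n : ℕ} (g : EuclideanSpace ℂ (Fin n) → EuclideanSpace ℂ (Fin n))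
    (hpoly : ∃ p : Fin n → MvPolynomial (Fin n) ℂ,
      ∀ (z : EuclideanSpace ℂ (Fin n)) (j : Fin n),
        g z j = MvPolynomial.eval (fun i => z i) (p j)) : ContDiff ℂ ω g := by
  obtain ⟨p, hp⟩ := hpoly
  rw [contDiff_euclidean]
  intro j
  simp only [hp]
  induction p j using MvPolynomial.induction_on with
  | C a => simpa using contDiff_const
  | add p q h1 h2 => simpa using h1.add h2
  | mul_X p i h1 =>
    simp only [map_mul, MvPolynomial.eval_X]
    exact h1.mul (by fun_prop)

lemma sm_inv {E : Type*} [NormedAddCommGroup E] [NormedSpace ℂ E] [CompleteSpace E]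
    (T : E →L[ℂ] E) (c : ℝ) (hc : c < 1) (hT : ‖T - 1‖ ≤ c) :
    (∃ e : E ≃L[ℂ] E, (e : E →L[ℂ] E) = T) ∧ ∀ v, (1 - c) * ‖v‖ ≤ ‖T v‖ := by
  constructor
  · have h : ‖1 - T‖ < 1 := by rw [norm_sub_rev]; linarith
    have := isUnit_one_sub_of_norm_lt_one h
    rw [sub_sub_cancel] at this
    obtain ⟨U, hU⟩ := this
    exact ⟨ContinuousLinearEquiv.unitsEquiv ℂ E U, by ext v; simp [hU]⟩
  · intro v
    have h1 : ‖(T - 1) v‖ ≤ c * ‖v‖ :=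
      ((T-1).le_opNorm v).trans (mul_le_mul_of_nonneg_right hT (norm_nonneg _))
    have h2 : v = T v - (T - 1) v := by simp
    have h3 : ‖v‖ ≤ ‖T v‖ + ‖(T-1) v‖ := by
      conv_lhs => rw [h2]
      exact norm_sub_le _ _
    linarith

/-- **Smale's α-theorem.** If `g` is a square polynomial system, the Jacobian of `g`
at `zhat` is invertible, and `α(g, zhat) < (13 − 3√17)/4`, then there is a zero `ζ` of `g`
with `‖ζ − zhat‖ ≤ 2β(g, zhat)`, all Newton iterates are defined, and
`‖N_g^k(zhat) − ζ‖ ≤ (1/2)^{2ᵏ−1}·2β(g, zhat)` for all `k`. -/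
theorem smale_alpha_theorem (n : ℕ)
    (g : EuclideanSpace ℂ (Fin n) → EuclideanSpace ℂ (Fin n))
    (hpoly : ∃ p : Fin n → MvPolynomial (Fin n) ℂ,
      ∀ (z : EuclideanSpace ℂ (Fin n)) (j : Fin n),
        g z j = MvPolynomial.eval (fun i => z i) (p j))
    (zhat : EuclideanSpace ℂ (Fin n))
    (hinv : jacobianInvertible g zhat)
    (hα : alphaVal g zhat < (13 - 3 * Real.sqrt 17) / 4) :
    ∃ ζ : EuclideanSpace ℂ (Fin n), g ζ = 0 ∧ ‖ζ - zhat‖ ≤ 2 * betaVal g zhat ∧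
      (∀ k : ℕ, jacobianInvertible g ((newtonMap g)^[k] zhat)) ∧
      (∀ k : ℕ, ‖(newtonMap g)^[k] zhat - ζ‖ ≤ (1 / 2 : ℝ) ^ (2 ^ k - 1) * (2 * betaVal g zhat)) := by
  have hg : ContDiff ℂ ω g := sm_poly g hpoly
  obtain ⟨γ0, hγ⟩ := sm_gamma g hg zhat
  have β0 : 0 ≤ betaVal g zhat := norm_nonneg _
  obtain ⟨t, a, t00, t0, tm, ta, tb, tγ, t2, tN⟩ :=
    scalar_seq (betaVal g zhat) (gammaVal g zhat) β0 γ0 hα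
  have hβ : betaVal g zhat = ‖((fderiv ℂ g zhat).inverse ∘ g) zhat‖ := rfl
  generalize betaVal g zhat = β at *
  generalize gammaVal g zhat = γ at *
  obtain ⟨e0, he0⟩ := hinv
  have hA : (fderiv ℂ g zhat).inverse =
      (e0.symm : EuclideanSpace ℂ (Fin n) →L[ℂ] EuclideanSpace ℂ (Fin n)) := by
    rw [← he0, ContinuousLinearMap.inverse_equiv]
  rw [hA] at hγ hβ
  set f := (e0.symm : EuclideanSpace ℂ (Fin n) →L[ℂ] EuclideanSpace ℂ (Fin n)) ∘ g with hfdef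
  have hf : ContDiff ℂ ω f := (ContinuousLinearMap.contDiff _).comp hg
  have hfd : ∀ z, fderiv ℂ f z = (e0.symm : EuclideanSpace ℂ (Fin n) →L[ℂ] _).comp (fderiv ℂ g z) :=
    fun z => by
      rw [hfdef, fderiv_comp z (ContinuousLinearMap.differentiableAt _)
        (hg.differentiable (by simp) z), ContinuousLinearMap.fderiv]
  have hf0 : fderiv ℂ f zhat = 1 := by
    rw [hfd, ← he0]; ext v; simp
  have hgf : ∀ z, g z = e0 (f z) := fun z => by simp [hfdef]
  have hgfd : ∀ z, fderiv ℂ g z = (e0 : EuclideanSpace ℂ (Fin n) →L[ℂ] _).comp (fderiv ℂ f z) :=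
    fun z => by rw [hfd]; ext v; simp
  -- the local step
  have hstep : ∀ z k, ‖z - zhat‖ ≤ t k →
      jacobianInvertible g z ∧ fderiv ℂ f z (newtonMap g z - z) = - f z ∧
      (‖f z‖ ≤ β - t k + γ * (t k)^2/(1-γ * t k) → ‖newtonMap g z - z‖ ≤ t (k+1) - t k) := by
    intro z k hz
    have h1 := sm_lip f hf zhat γ γ0 hγ zhat z 0 (t k) (by simp) hz (by simpa using tγ k)
    rw [hf0] at h1
    have hc : 1 / (1 - γ * (0 + t k)) ^ 2 - 1 / (1 - γ * 0) ^ 2 = 1/(1-γ * t k)^2 - 1 := by simp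
    rw [hc] at h1
    obtain ⟨⟨e, he⟩, hlow⟩ := sm_inv _ _ (by linarith [t2 k]) h1
    have hge : ((e.trans e0 : EuclideanSpace ℂ (Fin n) ≃L[ℂ] EuclideanSpace ℂ (Fin n)) :
        EuclideanSpace ℂ (Fin n) →L[ℂ] EuclideanSpace ℂ (Fin n)) = fderiv ℂ g z := by
      rw [hgfd, ← he]; ext v; simp
    have hnw : fderiv ℂ f z (newtonMap g z - z) = - f z := by
      have : newtonMap g z - z = - (e.trans e0).symm (g z) := by
        rw [newtonMap, ← hge, ContinuousLinearMap.inverse_equiv]; simp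
      rw [this, hgf, ← he]; simp
    refine ⟨⟨_, hge⟩, hnw, fun hfz => ?_⟩
    have h3 := hlow (newtonMap g z - z)
    rw [hnw, norm_neg] at h3
    have h4 := tN k
    have hpos : 0 < 2 - 1/(1-γ * t k)^2 := by linarith [t2 k]
    have h5 : (2 - 1/(1-γ * t k)^2) * ‖newtonMap g z - z‖ ≤
        (2 - 1/(1-γ * t k)^2) * (t (k+1) - t k) := by linarith
    exact le_of_mul_le_mul_left h5 hpos
  set z : ℕ → EuclideanSpace ℂ (Fin n) := fun k => (newtonMap g)^[k] zhat with hzdef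
  have hzs : ∀ k, z (k+1) = newtonMap g (z k) := fun k => Function.iterate_succ_apply' _ _ _
  have hind : ∀ k, ‖z k - zhat‖ ≤ t k ∧ ‖f (z k)‖ ≤ β - t k + γ * (t k)^2/(1-γ * t k) := by
    intro k
    induction k with
    | zero => simp [hzdef, t00, hβ]
    | succ k ih =>
      obtain ⟨_, h2, h3⟩ := hstep (z k) k ih.1
      have h4 := h3 ih.2
      rw [← hzs] at h2 h4
      constructor
      · have : z (k+1) - zhat = (z (k+1) - z k) + (z k - zhat) := by abel
        rw [this]; linarith [norm_add_le (z (k+1) - z k) (z k - zhat), ih.1]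
      · have h5 := sm_rem f hf zhat γ γ0 hγ (z k) (z (k+1)) (t k) (t (k+1) - t k) ih.1 h4
          (by simpa using tγ (k+1))
        rw [h2, add_sub_cancel, show f (z (k+1)) - f (z k) - -f (z k) = f (z (k+1)) by abel] at h5
        linarith [tN k]
  have hd : ∀ k, ‖z (k+1) - z k‖ ≤ t (k+1) - t k := fun k => by
    rw [hzs]; exact (hstep (z k) k (hind k).1).2.2 (hind k).2
  have hdist : ∀ k j, ‖z (k+j) - z k‖ ≤ t (k+j) - t k := by
    intro k j
    induction j with
    | zero => simp
    | succ j ih =>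
      have h1 := hd (k+j)
      have : z (k+(j+1)) - z k = (z (k+j+1) - z (k+j)) + (z (k+j) - z k) := by
        rw [← add_assoc]; abel
      rw [this, ← add_assoc]
      linarith [norm_add_le (z (k+j+1) - z (k+j)) (z (k+j) - z k)]
  have hlim : Filter.Tendsto (fun k => a - t k) Filter.atTop (nhds 0) := by
    have hge : Filter.Tendsto (fun k : ℕ => (1/2:ℝ)^k * (2*β)) Filter.atTop (nhds 0) := by
      simpa using (tendsto_pow_atTop_nhds_zero_of_lt_one (r := (1/2:ℝ)) (by norm_num)
        (by norm_num)).mul_const (2*β)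
    refine squeeze_zero (fun k => by linarith [ta k]) (fun k => (tb k).trans ?_) hge
    refine mul_le_mul_of_nonneg_right ?_ (by positivity)
    refine pow_le_pow_of_le_one (by norm_num) (by norm_num) ?_
    have := Nat.lt_two_pow_self (n := k)
    omega
  have hcau : CauchySeq z := by
    refine cauchySeq_of_le_tendsto_0' (fun k => a - t k) (fun k m hkm => ?_) hlim
    obtain ⟨j, rfl⟩ := Nat.exists_eq_add_of_le hkm
    rw [dist_comm, dist_eq_norm]
    exact (hdist k j).trans (by linarith [ta (k+j)])
  obtain ⟨ζ, hζ⟩ := cauchySeq_tendsto_of_complete hcau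
  have herr : ∀ k, ‖z k - ζ‖ ≤ a - t k := by
    intro k
    have h1 : Filter.Tendsto (fun m => ‖z k - z m‖) Filter.atTop (nhds ‖z k - ζ‖) :=
      (tendsto_const_nhds.sub hζ).norm
    refine le_of_tendsto h1 ?_
    filter_upwards [Filter.eventually_ge_atTop k] with m hkm
    obtain ⟨j, rfl⟩ := Nat.exists_eq_add_of_le hkm
    rw [norm_sub_rev]
    exact (hdist k j).trans (by linarith [ta (k+j)])
  have hfζ : f ζ = 0 := by
    have h1 : Filter.Tendsto (fun m => f (z m)) Filter.atTop (nhds (f ζ)) :=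
      (hf.continuous.tendsto ζ).comp hζ
    have h2 : Filter.Tendsto (fun m => f (z m)) Filter.atTop (nhds 0) := by
      refine squeeze_zero_norm (a := fun k => 2 * (a - t k)) (fun k => ?_)
        (by simpa using hlim.const_mul 2)
      refine (hind k).2.trans ?_
      have h3 := tN k
      have h4 : 0 ≤ 1/(1-γ * t k)^2 := by positivity
      have h5 := mul_nonneg h4 (sub_nonneg.2 (tm k))
      nlinarith [ta (k+1)]
    exact tendsto_nhds_unique h1 h2
  refine ⟨ζ, by rw [hgf, hfζ, map_zero], ?_, fun k => (hstep (z k) k (hind k).1).1,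
    fun k => (herr k).trans (tb k)⟩
  have h := (herr 0).trans (tb 0)
  rw [norm_sub_rev]
  simpa [hzdef] using h
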